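/- arXiv:2605.03225 — 5 statements merged into one kernel-verified Lean document; each statement's English description precedes it below -/
import Mathlib

section
/- Let k ≥ 1 be an integer and let B be a finite simple biconnected graph with tw(B) ≥ 2k − 1. Then for any two distinct vertices s, t of B there exists a simple (s,t)-path in B of length at least k. -/
/-- A tree decomposition of a simple graph `G`: a finite nonempty tree `T` together with
bags such that every vertex's set of bags is nonempty and induces a connected subtree,
and every edge is contained in some bag. -/
structure TreeDecomp {V : Type} (G : SimpleGraph V) where
  ι : Type
  instFin : Fintype ι
  T : SimpleGraph ι
  isTree : T.IsTree
  bag : ι → Finset V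
  bag_conn : ∀ v : V, (SimpleGraph.induce {i | v ∈ bag i} T).Connected
  bag_edge : ∀ ⦃u v : V⦄, G.Adj u v → ∃ i, u ∈ bag i ∧ v ∈ bag i

/-- The width of a tree decomposition: maximum bag size minus 1. -/
noncomputable def TreeDecomp.width {V : Type} {G : SimpleGraph V} (td : TreeDecomp G) : ℕ :=
  (@Finset.univ td.ι td.instFin).sup (fun i => (td.bag i).card) - 1

/-- The treewidth of a graph: the minimum width over all tree decompositions. -/
noncomputable def treewidth {V : Type} (G : SimpleGraph V) : ℕ :=
  sInf {w | ∃ td : TreeDecomp G, td.width = w}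

/-- Two vertices `u`, `v` of `G` are biconnected: either `uv` is an edge, or there are two
`(u,v)`-paths that are vertex-disjoint except for their common endpoints `u` and `v`. -/
def Biconn {V : Type} (G : SimpleGraph V) (u v : V) : Prop :=
  G.Adj u v ∨ ∃ (p q : G.Walk u v), p.IsPath ∧ q.IsPath ∧
    ∀ x ∈ p.support, x ∈ q.support → x = u ∨ x = v

namespace SimpleGraph

variable {V : Type} {G : SimpleGraph V}

/-! ### Concatenating and splitting paths -/

theorem Walk.IsPath.append_of_disjoint {u v w : V} {p : G.Walk u v} {q : G.Walk v w}
    (hp : p.IsPath) (hq : q.IsPath) (h : ∀ x ∈ p.support, x ∈ q.support → x = v) :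
    (p.append q).IsPath := by
  induction p with
  | nil => simpa using hq
  | @cons a b c hab p ih =>
    rw [Walk.cons_isPath_iff] at hp
    rw [Walk.cons_append, Walk.cons_isPath_iff]
    refine ⟨ih hp.1 hq fun x hx => h x (by simp [hx]), fun ha => ?_⟩
    rcases (Walk.mem_support_append_iff _ _).1 ha with ha | ha
    · exact hp.2 ha
    · exact hp.2 (h a (by simp) ha ▸ p.end_mem_support)

theorem Walk.IsPath.eq_of_mem_append {u v w x : V} {p : G.Walk u v} {q : G.Walk v w}
    (h : (p.append q).IsPath) (hp : x ∈ p.support) (hq : x ∈ q.support) : x = v := by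
  by_contra hne
  exact h.ne_of_mem_support_of_append hne hp hq rfl

/-- Two vertices of a walk split it into three pieces, in one of the two possible orders. -/
theorem Walk.exists_three_pieces {a b x y : V} (q : G.Walk a b)
    (hx : x ∈ q.support) (hy : y ∈ q.support) :
    (∃ (p₁ : G.Walk a x) (p₂ : G.Walk x y) (p₃ : G.Walk y b), q = p₁.append (p₂.append p₃)) ∨
      ∃ (p₁ : G.Walk a y) (p₂ : G.Walk y x) (p₃ : G.Walk x b),
        q = p₁.append (p₂.append p₃) := by
  obtain ⟨r₁, r₂, rfl⟩ := Walk.mem_support_iff_exists_append.1 hx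
  rcases (Walk.mem_support_append_iff _ _).1 hy with hy | hy
  · obtain ⟨s₁, s₂, rfl⟩ := Walk.mem_support_iff_exists_append.1 hy
    exact .inr ⟨s₁, s₂, r₂, by rw [Walk.append_assoc]⟩
  · obtain ⟨s₁, s₂, rfl⟩ := Walk.mem_support_iff_exists_append.1 hy
    exact .inl ⟨r₁, s₁, s₂, rfl⟩

/-- A walk ending in `S` contains a path from its start to `S` meeting `S` only at its end. -/
theorem Walk.exists_path_to_set {z c : V} (p : G.Walk z c) (S : Set V) (hc : c ∈ S) :
    ∃ b ∈ S, ∃ q : G.Walk z b, q.IsPath ∧ (∀ x ∈ q.support, x ∈ p.support) ∧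
      ∀ x ∈ q.support, x ∈ S → x = b := by
  classical
  suffices h : ∃ b ∈ S, ∃ q : G.Walk z b, (∀ x ∈ q.support, x ∈ p.support) ∧
      ∀ x ∈ q.support, x ∈ S → x = b by
    obtain ⟨b, hb, q, hq, hqS⟩ := h
    exact ⟨b, hb, q.bypass, q.bypass_isPath,
      fun x hx => hq x (q.support_bypass_subset_support hx),
      fun x hx => hqS x (q.support_bypass_subset_support hx)⟩
  induction p with
  | nil => exact ⟨_, hc, .nil, by simp, by simp⟩
  | @cons u v w huv p ih =>
    by_cases hu : u ∈ S
    · exact ⟨u, hu, .nil, by simp, by simp⟩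
    · obtain ⟨b, hb, q, hq, hqS⟩ := ih hc
      refine ⟨b, hb, .cons huv q, ?_, ?_⟩
      · intro x hx
        rw [Walk.support_cons, List.mem_cons] at hx ⊢
        exact hx.imp_right (hq x)
      · intro x hx hxS
        rw [Walk.support_cons, List.mem_cons] at hx
        rcases hx with rfl | hx
        · exact absurd hxS hu
        · exact hqS x hx hxS

/-! ### Sets of vertices that are pairwise joined by long paths -/

/-- `x` and `y` are joined by a path of length at least `k` inside `S`. -/
def HasLongPath (G : SimpleGraph V) (k : ℕ) (S : Set V) (x y : V) : Prop :=
  ∃ p : G.Walk x y, p.IsPath ∧ k ≤ p.length ∧ ∀ z ∈ p.support, z ∈ S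

theorem HasLongPath.symm {k : ℕ} {S : Set V} {x y : V} (h : G.HasLongPath k S x y) :
    G.HasLongPath k S y x := by
  obtain ⟨p, hp, hk, hS⟩ := h
  exact ⟨p.reverse, hp.reverse, by simpa using hk, fun z hz => hS z (by simpa using hz)⟩

theorem HasLongPath.mono {k : ℕ} {S S' : Set V} {x y : V} (h : G.HasLongPath k S x y)
    (hSS' : S ⊆ S') : G.HasLongPath k S' x y := by
  obtain ⟨p, hp, hk, hS⟩ := h
  exact ⟨p, hp, hk, fun z hz => hSS' (hS z hz)⟩

theorem HasLongPath.append {k : ℕ} {S S' : Set V} {x a y : V} (h : G.HasLongPath k S x a)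
    {q : G.Walk a y} (hq : q.IsPath) (hSS' : S ⊆ S') (hqS' : ∀ z ∈ q.support, z ∈ S')
    (hqS : ∀ z ∈ q.support, z ∈ S → z = a) : G.HasLongPath k S' x y := by
  obtain ⟨p, hp, hk, hS⟩ := h
  refine ⟨p.append q, hp.append_of_disjoint hq fun z hz hz' => hqS z hz' (hS z hz), ?_, ?_⟩
  · rw [Walk.length_append]; omega
  · intro z hz
    rcases (Walk.mem_support_append_iff _ _).1 hz with hz | hz
    · exact hSS' (hS z hz)
    · exact hqS' z hz

/-- Any two vertices of a cycle of length at least `2 * k` are joined by a path of length at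
least `k`; the cycle is given by a path and an edge between its endpoints. -/
theorem hasLongPath_of_cycle {u w : V} {k : ℕ} (P : G.Walk u w) (hP : P.IsPath)
    (hlen : 2 * k ≤ P.length + 1) (huw : G.Adj u w) :
    {z | z ∈ P.support}.Pairwise (G.HasLongPath k {z | z ∈ P.support}) := by
  suffices h : ∀ x y, x ≠ y → ∀ (p₁ : G.Walk u x) (p₂ : G.Walk x y) (p₃ : G.Walk y w),
      P = p₁.append (p₂.append p₃) → G.HasLongPath k {z | z ∈ P.support} x y by
    intro x hx y hy hxy
    rcases P.exists_three_pieces hx hy with ⟨p₁, p₂, p₃, hp⟩ | ⟨p₁, p₂, p₃, hp⟩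
    · exact h x y hxy p₁ p₂ p₃ hp
    · exact (h y x hxy.symm p₁ p₂ p₃ hp).symm
  rintro x y hxy p₁ p₂ p₃ rfl
  have h₂₃ := hP.of_append_right
  by_cases hk : k ≤ p₂.length
  · exact ⟨p₂, h₂₃.of_append_left, hk, fun z hz => by simp [hz]⟩
  have hdisj : ∀ z ∈ p₁.support, z ∉ p₃.support := by
    intro z hz hz'
    have hzx := hP.eq_of_mem_append hz (by simp [hz'])
    subst hzx
    exact hxy (h₂₃.eq_of_mem_append p₂.start_mem_support hz')
  refine ⟨p₁.reverse.append (.cons huw p₃.reverse), ?_, ?_, ?_⟩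
  · refine hP.of_append_left.reverse.append_of_disjoint ?_ ?_
    · rw [Walk.cons_isPath_iff]
      exact ⟨h₂₃.of_append_right.reverse, by simpa using hdisj u p₁.start_mem_support⟩
    · intro z hz hz'
      rw [Walk.support_cons, List.mem_cons] at hz'
      exact hz'.resolve_right (by simpa using hdisj z (by simpa using hz))
  · simp only [Walk.length_append, Walk.length_cons, Walk.length_reverse] at hlen ⊢
    omega
  · intro z hz
    simp only [Walk.mem_support_append_iff, Walk.support_cons, Walk.support_reverse,
      List.mem_cons, List.mem_reverse, Set.mem_ofPred_eq] at hz ⊢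
    rcases hz with hz | rfl | hz
    · exact .inl hz
    · exact .inl p₁.start_mem_support
    · exact .inr (.inr hz)

/-- Adding an ear to a set of vertices preserves being pairwise joined by long paths. -/
theorem hasLongPath_of_ear {k : ℕ} {S : Set V} (hS : S.Pairwise (G.HasLongPath k S))
    {a b : V} (ha : a ∈ S) (hb : b ∈ S) (hab : a ≠ b) (q : G.Walk a b) (hq : q.IsPath)
    (hqS : ∀ z ∈ q.support, z ∈ S → z = a ∨ z = b) :
    (S ∪ {z | z ∈ q.support}).Pairwise (G.HasLongPath k (S ∪ {z | z ∈ q.support})) := by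
  have hmixed : ∀ x ∈ S, ∀ y ∈ q.support, y ∉ S →
      G.HasLongPath k (S ∪ {z | z ∈ q.support}) x y := by
    intro x hx y hy hyS
    obtain ⟨q₁, q₂, rfl⟩ := Walk.mem_support_iff_exists_append.1 hy
    by_cases hxa : x = a
    · have hxb : x ≠ b := hxa ▸ hab
      refine (hS hx hb hxb).append hq.of_append_right.reverse Set.subset_union_left
        (fun z hz => .inr ?_) fun z hz hzS => ?_
      · rw [Walk.support_reverse, List.mem_reverse] at hz
        simp [hz]
      · rw [Walk.support_reverse, List.mem_reverse] at hz
        refine (hqS z (by simp [hz]) hzS).resolve_left ?_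
        rintro rfl
        exact hyS (hq.eq_of_mem_append q₁.start_mem_support hz ▸ ha)
    · refine (hS hx ha hxa).append hq.of_append_left Set.subset_union_left
        (fun z hz => .inr (by simp [hz])) fun z hz hzS => ?_
      refine (hqS z (by simp [hz]) hzS).resolve_right ?_
      rintro rfl
      exact hyS (hq.eq_of_mem_append hz q₂.end_mem_support ▸ hb)
  have hinner : ∀ x y, x ≠ y → x ∉ S → y ∉ S →
      ∀ (p₁ : G.Walk a x) (p₂ : G.Walk x y) (p₃ : G.Walk y b),
      q = p₁.append (p₂.append p₃) → G.HasLongPath k (S ∪ {z | z ∈ q.support}) x y := by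
    rintro x y hxy hxS hyS p₁ p₂ p₃ rfl
    have h₂₃ := hq.of_append_right
    have hbx : b ∉ p₁.support := fun hb' =>
      hxS (hq.eq_of_mem_append hb' (by simp) ▸ hb)
    have hay : a ∉ p₃.support := fun ha' =>
      hxS (hq.eq_of_mem_append p₁.start_mem_support (by simp [ha']) ▸ ha)
    have hxb : G.HasLongPath k (S ∪ {z | z ∈ p₁.support}) b x := by
      refine (hS hb ha hab.symm).append hq.of_append_left Set.subset_union_left
        (fun z hz => .inr hz) fun z hz hzS => ?_
      refine (hqS z (by simp [hz]) hzS).resolve_right ?_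
      rintro rfl
      exact hbx hz
    refine hxb.symm.append h₂₃.of_append_right.reverse ?_ ?_ ?_
    · refine Set.union_subset_union_right _ fun z hz => ?_
      simp only [Set.mem_ofPred_eq] at hz ⊢
      simp [hz]
    · intro z hz
      rw [Walk.support_reverse, List.mem_reverse] at hz
      exact .inr (by simp [hz])
    · intro z hz hzS
      rw [Walk.support_reverse, List.mem_reverse] at hz
      rcases hzS with hzS | hzp
      · refine (hqS z (by simp [hz]) hzS).resolve_left ?_
        rintro rfl
        exact hay hz
      · have hzx := hq.eq_of_mem_append hzp (by simp [hz])
        subst hzx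
        exact absurd (h₂₃.eq_of_mem_append p₂.start_mem_support hz) hxy
  intro x hx y hy hxy
  by_cases hxS : x ∈ S <;> by_cases hyS : y ∈ S
  · exact (hS hxS hyS hxy).mono Set.subset_union_left
  · exact hmixed x hxS y (hy.resolve_left hyS) hyS
  · exact (hmixed y hyS x (hx.resolve_left hxS) hxS).symm
  · rcases q.exists_three_pieces (hx.resolve_left hxS) (hy.resolve_left hyS) with
      ⟨p₁, p₂, p₃, hp⟩ | ⟨p₁, p₂, p₃, hp⟩
    · exact hinner x y hxy hxS hyS p₁ p₂ p₃ hp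
    · exact (hinner y x hxy.symm hyS hxS p₁ p₂ p₃ hp).symm

end SimpleGraph

theorem Biconn.exists_walk_avoiding {V : Type} {G : SimpleGraph V} {u v a : V}
    (h : Biconn G u v) (hu : u ≠ a) (hv : v ≠ a) : ∃ p : G.Walk u v, a ∉ p.support := by
  rcases h with h | ⟨p, q, -, -, hpq⟩
  · exact ⟨h.toWalk, by simp [hu.symm, hv.symm]⟩
  · by_cases hp : a ∈ p.support
    · refine ⟨q, fun hq => ?_⟩
      rcases hpq a hp hq with rfl | rfl
      · exact hu rfl
      · exact hv rfl
    · exact ⟨p, hp⟩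

theorem preconnected_of_biconn {V : Type} {G : SimpleGraph V}
    (hG : ∀ u v : V, u ≠ v → Biconn G u v) : G.Preconnected := by
  intro u v
  by_cases huv : u = v
  · exact huv ▸ .rfl
  · rcases hG u v huv with h | ⟨p, -⟩
    · exact h.reachable
    · exact p.reachable

namespace SimpleGraph

variable {V : Type} {G : SimpleGraph V}

/-- In a biconnected graph, a set of vertices pairwise joined by long paths can be enlarged to
the whole vertex set by adding ears. -/
theorem hasLongPath_univ [Finite V] (hG : ∀ u v : V, u ≠ v → Biconn G u v) {k : ℕ} {S : Set V}
    (hS : S.Pairwise (G.HasLongPath k S)) (hS₂ : S.Nontrivial) :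
    (Set.univ : Set V).Pairwise (G.HasLongPath k Set.univ) := by
  obtain ⟨M, hSM, hM⟩ := Set.Finite.exists_le_maximal
    (Set.toFinite {M : Set V | M.Pairwise (G.HasLongPath k M)}) hS
  suffices h : M = Set.univ from h ▸ hM.prop
  by_contra hne
  obtain ⟨v, hv⟩ := (Set.ne_univ_iff_exists_notMem M).1 hne
  obtain ⟨u, hu⟩ := hS₂.nonempty
  obtain ⟨p⟩ := preconnected_of_biconn hG u v
  obtain ⟨⟨⟨a, z⟩, haz⟩, -, ha, hz⟩ := p.exists_boundary_dart M (hSM hu) hv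
  dsimp only at haz ha hz
  obtain ⟨c, hc, hca⟩ := (hS₂.mono hSM).exists_ne a
  have hzc : z ≠ c := fun h => hz (h ▸ hc)
  obtain ⟨r, hr⟩ := (hG z c hzc).exists_walk_avoiding haz.ne' hca
  obtain ⟨b, hb, q, hq, hqr, hqM⟩ := r.exists_path_to_set M hc
  have haq : a ∉ q.support := fun h => hr (hqr a h)
  have hab : a ≠ b := fun h => haq (h ▸ q.end_mem_support)
  have hear := hasLongPath_of_ear hM.prop ha hb hab (.cons haz q)
    ((Walk.cons_isPath_iff _ _).2 ⟨hq, haq⟩) (by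
      intro x hx hxM
      rw [Walk.support_cons, List.mem_cons] at hx
      exact hx.imp_right fun hx => hqM x hx hxM)
  exact hz (hM.le_of_ge hear Set.subset_union_left (.inr (by simp)))

/-! ### Rooted spanning trees -/

/-- A spanning tree of `G` rooted at `r`, given by its parent and depth functions. -/
structure IsRootedTree (G : SimpleGraph V) (r : V) (par : V → V) (d : V → ℕ) : Prop where
  par_root : par r = r
  adj_par : ∀ v, v ≠ r → G.Adj v (par v)
  depth_par : ∀ v, v ≠ r → d v = d (par v) + 1
  depth_root : d r = 0

/-- `IsAncestor par v u` means that `u` is obtained from `v` by iterating `par`. -/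
def IsAncestor (par : V → V) : V → V → Prop :=
  Relation.ReflTransGen fun v u => par v = u

theorem IsAncestor.par_left {par : V → V} {v u : V} (h : IsAncestor par v u) (hne : v ≠ u) :
    IsAncestor par (par v) u := by
  rcases Relation.ReflTransGen.cases_head h with rfl | ⟨c, rfl, hc⟩
  · exact absurd rfl hne
  · exact hc

theorem isAncestor_of_par {par : V → V} {v u : V} (h : IsAncestor par (par v) u) :
    IsAncestor par v u :=
  Relation.ReflTransGen.head rfl h

theorem IsAncestor.total {par : V → V} {v u w : V} (hu : IsAncestor par v u)
    (hw : IsAncestor par v w) : IsAncestor par u w ∨ IsAncestor par w u :=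
  Relation.ReflTransGen.total_of_right_unique (fun _ _ _ h h' => h.symm.trans h') hu hw

namespace IsRootedTree

variable {r : V} {par : V → V} {d : V → ℕ}

theorem isAncestor_root (h : G.IsRootedTree r par d) (v : V) : IsAncestor par v r := by
  induction hn : d v generalizing v with
  | zero =>
    by_cases hv : v = r
    · exact hv ▸ .refl
    · have := h.depth_par v hv
      omega
  | succ n ih =>
    by_cases hv : v = r
    · exact hv ▸ .refl
    · have := h.depth_par v hv
      exact isAncestor_of_par (ih _ (by omega))

theorem eq_root_of_isAncestor (h : G.IsRootedTree r par d) {u : V} (hu : IsAncestor par r u) :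
    u = r := by
  induction hu with
  | refl => rfl
  | tail _ hb ih => rw [← hb, ih, h.par_root]

/-- The tree path from a vertex to one of its ancestors. -/
theorem exists_path (h : G.IsRootedTree r par d) {v u : V} (hvu : IsAncestor par v u) :
    ∃ p : G.Walk v u, p.IsPath ∧ p.length + d u = d v ∧ ∀ x ∈ p.support, d x ≤ d v := by
  induction hvu using Relation.ReflTransGen.head_induction_on with
  | refl => exact ⟨.nil, by simp, by simp, by simp⟩
  | @head a c hac hcu ih =>
    subst hac
    obtain ⟨p, hp, hlen, hd⟩ := ih
    by_cases ha : a = r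
    · subst ha
      obtain rfl := h.eq_root_of_isAncestor (isAncestor_of_par hcu)
      exact ⟨.nil, by simp, by simp, by simp⟩
    · have hda := h.depth_par a ha
      refine ⟨.cons (h.adj_par a ha) p, ?_, by rw [Walk.length_cons]; omega, ?_⟩
      · refine (Walk.cons_isPath_iff _ _).2 ⟨hp, fun ha' => ?_⟩
        have := hd a ha'
        omega
      · intro x hx
        rw [Walk.support_cons, List.mem_cons] at hx
        rcases hx with rfl | hx
        · exact le_rfl
        · have := hd x hx
          omega

theorem depth_le (h : G.IsRootedTree r par d) {v u : V} (hvu : IsAncestor par v u) :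
    d u ≤ d v := by
  obtain ⟨p, -, hp, -⟩ := h.exists_path hvu
  omega

theorem eq_of_depth_eq (h : G.IsRootedTree r par d) {v u : V} (hvu : IsAncestor par v u)
    (hd : d u = d v) : v = u := by
  obtain ⟨p, -, hp, -⟩ := h.exists_path hvu
  exact Walk.eq_of_length_eq_zero (p := p) (by omega)

theorem depth_lt_card [Fintype V] (h : G.IsRootedTree r par d) (v : V) :
    d v < Fintype.card V := by
  obtain ⟨p, hp, hlen, -⟩ := h.exists_path (h.isAncestor_root v)
  have := hp.length_lt
  have := h.depth_root
  omega

/-- Reattaching the subtree rooted at `w` below a neighbour `u` outside of this subtree. -/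
theorem reattach [DecidableEq V] (h : G.IsRootedTree r par d) {u w : V} (huw : G.Adj u w)
    (hanc : ¬ IsAncestor par u w) (hd : d w ≤ d u) :
    ∃ d' : V → ℕ, G.IsRootedTree r (Function.update par w u) d' ∧ (∀ x, d x ≤ d' x) ∧
      d w < d' w := by
  classical
  have hwr : w ≠ r := by
    rintro rfl
    exact hanc (h.isAncestor_root u)
  refine ⟨fun x => if IsAncestor par x w then d x - d w + d u + 1 else d x, ⟨?_, ?_, ?_, ?_⟩,
    fun x => ?_, ?_⟩
  · rw [Function.update_of_ne hwr.symm, h.par_root]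
  · intro v hv
    by_cases hvw : v = w
    · subst hvw
      simpa using huw.symm
    · rw [Function.update_of_ne hvw]
      exact h.adj_par v hv
  · intro v hv
    by_cases hvw : v = w
    · subst hvw
      have : IsAncestor par v v := .refl
      simp [hanc, this]
    · have hiff : IsAncestor par (par v) w ↔ IsAncestor par v w :=
        ⟨isAncestor_of_par, fun hv => hv.par_left hvw⟩
      have hdv := h.depth_par v hv
      simp only [Function.update_of_ne hvw, hiff]
      split_ifs with hvw'
      · have := h.depth_le (hiff.2 hvw')
        omega
      · exact hdv
  · have : ¬ IsAncestor par r w := fun hr => hwr (h.eq_root_of_isAncestor hr)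
    simp [this, h.depth_root]
  · dsimp only
    split_ifs <;> omega
  · have : IsAncestor par w w := .refl
    simp only [this, if_true]
    omega

end IsRootedTree

theorem Connected.exists_isRootedTree (hG : G.Connected) (r : V) :
    ∃ par d, G.IsRootedTree r par d := by
  classical
  have key : ∀ v, ∃ u, v ≠ r → G.Adj v u ∧ G.dist v r = G.dist u r + 1 := by
    intro v
    by_cases hv : v = r
    · exact ⟨v, fun h => absurd hv h⟩
    obtain ⟨p, hp⟩ := hG.exists_walk_length_eq_dist v r
    cases p with
    | nil => exact absurd rfl hv
    | @cons _ u _ hvu p =>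
      refine ⟨u, fun _ => ⟨hvu, ?_⟩⟩
      rw [Walk.length_cons] at hp
      have h₁ := dist_le p
      have h₂ := hG.dist_triangle (u := v) (v := u) (w := r)
      rw [dist_eq_one_iff_adj.2 hvu] at h₂
      omega
  choose f hf using key
  refine ⟨Function.update f r r, fun v => G.dist v r, by simp, ?_, ?_, by simp⟩
  · intro v hv
    rw [Function.update_of_ne hv]
    exact (hf v hv).1
  · intro v hv
    rw [Function.update_of_ne hv]
    exact (hf v hv).2

/-- Every finite connected graph has a normal spanning tree: one of maximal total depth. -/
theorem Connected.exists_normal_isRootedTree [Fintype V] (hG : G.Connected) (r : V) :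
    ∃ par d, G.IsRootedTree r par d ∧
      ∀ u v, G.Adj u v → IsAncestor par u v ∨ IsAncestor par v u := by
  classical
  obtain ⟨par₀, d₀, h₀⟩ := hG.exists_isRootedTree r
  let trees : Set ((V → V) × (V → ℕ)) := {t | G.IsRootedTree r t.1 t.2}
  have hfin : ((fun t : (V → V) × (V → ℕ) => ∑ v, t.2 v) '' trees).Finite := by
    refine (Set.finite_le_nat (∑ _v : V, Fintype.card V)).subset ?_
    rintro _ ⟨t, ht, rfl⟩
    exact Finset.sum_le_sum fun v _ => (IsRootedTree.depth_lt_card ht v).le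
  obtain ⟨⟨par, d⟩, ht, hmax⟩ := Set.Finite.exists_maximalFor' _ trees hfin ⟨(par₀, d₀), h₀⟩
  have h : G.IsRootedTree r par d := ht
  have key : ∀ u w, G.Adj u w → d w ≤ d u → IsAncestor par u w := by
    intro u w huw hd
    by_contra hanc
    obtain ⟨d', h', hle, hlt⟩ := h.reattach huw hanc hd
    have hsum : ∑ v, d v < ∑ v, d' v :=
      Finset.sum_lt_sum (fun v _ => hle v) ⟨w, Finset.mem_univ w, hlt⟩
    exact absurd (hmax (j := (Function.update par w u, d')) h' hsum.le) (not_le.2 hsum)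
  refine ⟨par, d, h, fun u v huv => ?_⟩
  rcases le_total (d v) (d u) with hd | hd
  · exact .inl (key u v huv hd)
  · exact .inr (key v u huv.symm hd)

/-! ### The tree decomposition of a normal spanning tree -/

/-- The tree on the vertex set with an edge from every vertex to its parent. -/
def parentGraph (par : V → V) : SimpleGraph V :=
  fromRel fun v u => par v = u

theorem parentGraph_adj {par : V → V} {v : V} (h : v ≠ par v) :
    (parentGraph par).Adj v (par v) := by
  simp [parentGraph, h]

theorem IsRootedTree.isTree_parentGraph [Finite V] {r : V} {par : V → V} {d : V → ℕ}
    (h : G.IsRootedTree r par d) : (parentGraph par).IsTree := by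
  classical
  have := Fintype.ofFinite V
  have hreach : ∀ v, (parentGraph par).Reachable v r := by
    intro v
    refine Relation.ReflTransGen.head_induction_on (h.isAncestor_root v) .rfl ?_
    rintro a c rfl - ih
    by_cases ha : a = par a
    · rwa [← ha] at ih
    · exact (parentGraph_adj ha).reachable.trans ih
  have hconn : (parentGraph par).Connected :=
    { preconnected := fun u v => (hreach u).trans (hreach v).symm
      nonempty := ⟨r⟩ }
  refine isTree_iff_connected_and_card.2
    ⟨hconn, le_antisymm ?_ hconn.card_vert_le_card_edgeSet_add_one⟩
  have hsub : (parentGraph par).edgeSet ⊆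
      ((Finset.univ.erase r).image fun v => s(v, par v) : Finset (Sym2 V)) := by
    intro e
    induction e with | _ x y =>
    simp only [mem_edgeSet, parentGraph, fromRel_adj, Finset.coe_image, Set.mem_image]
    rintro ⟨hxy, hx | hy⟩
    · refine ⟨x, ?_, by rw [hx]⟩
      suffices x ≠ r by simpa
      rintro rfl
      exact hxy (h.par_root.symm.trans hx)
    · refine ⟨y, ?_, by rw [hy, Sym2.eq_swap]⟩
      suffices y ≠ r by simpa
      rintro rfl
      exact hxy (hy.symm.trans h.par_root)
  have hcard := Nat.card_mono (Finset.finite_toSet _) hsub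
  rw [Nat.card_coe_set_eq, Nat.card_coe_set_eq, Set.ncard_coe_finset] at hcard
  have himg := hcard.trans Finset.card_image_le
  rw [Finset.card_erase_of_mem (Finset.mem_univ r), Finset.card_univ] at himg
  have hpos : 0 < Fintype.card V := Fintype.card_pos_iff.2 ⟨r⟩
  rw [Nat.card_coe_set_eq, Nat.card_eq_fintype_card]
  omega

/-- The vertex `v` together with its ancestors that are adjacent to a descendant of `v`. -/
noncomputable def normalBag [Fintype V] (G : SimpleGraph V) (par : V → V) (v : V) : Finset V :=
  open Classical in
  Finset.univ.filter fun u =>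
    u = v ∨ (IsAncestor par v u ∧ ∃ w, IsAncestor par w v ∧ G.Adj w u)

theorem mem_normalBag [Fintype V] {par : V → V} {v u : V} :
    u ∈ G.normalBag par v ↔
      u = v ∨ (IsAncestor par v u ∧ ∃ w, IsAncestor par w v ∧ G.Adj w u) := by
  simp [normalBag]

theorem isAncestor_of_mem_normalBag [Fintype V] {par : V → V} {v u : V}
    (h : u ∈ G.normalBag par v) : IsAncestor par v u := by
  rcases mem_normalBag.1 h with rfl | h
  · exact .refl
  · exact h.1

theorem mem_normalBag_par [Fintype V] {par : V → V} {v u : V} (h : u ∈ G.normalBag par v)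
    (hne : v ≠ u) : u ∈ G.normalBag par (par v) := by
  rcases mem_normalBag.1 h with rfl | ⟨hvu, w, hwv, hwu⟩
  · exact absurd rfl hne
  · exact mem_normalBag.2 (.inr ⟨hvu.par_left hne, w, hwv.tail rfl, hwu⟩)

/-- The tree decomposition obtained from a normal spanning tree. -/
noncomputable def IsRootedTree.treeDecomp [Fintype V] {r : V} {par : V → V} {d : V → ℕ}
    (h : G.IsRootedTree r par d)
    (hnormal : ∀ u v, G.Adj u v → IsAncestor par u v ∨ IsAncestor par v u) : TreeDecomp G where
  ι := V
  instFin := inferInstance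
  T := parentGraph par
  isTree := h.isTree_parentGraph
  bag := G.normalBag par
  bag_conn u := by
    have hu : u ∈ G.normalBag par u := mem_normalBag.2 (.inl rfl)
    have hreach : ∀ v (hv : u ∈ G.normalBag par v),
        (induce {i | u ∈ G.normalBag par i} (parentGraph par)).Reachable ⟨v, hv⟩ ⟨u, hu⟩ := by
      intro v hv
      have hvu := isAncestor_of_mem_normalBag hv
      induction hvu using Relation.ReflTransGen.head_induction_on with
      | refl => exact .rfl
      | @head a c hac _ ih =>
        subst hac
        by_cases hau : a = u
        · subst hau
          exact .rfl
        have hpar := mem_normalBag_par hv hau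
        by_cases ha : a = par a
        · have heq : (⟨a, hv⟩ : {i | u ∈ G.normalBag par i}) = ⟨par a, hpar⟩ := Subtype.ext ha
          rw [heq]
          exact ih hpar
        · have hadj : (induce {i | u ∈ G.normalBag par i} (parentGraph par)).Adj
              ⟨a, hv⟩ ⟨par a, hpar⟩ := parentGraph_adj ha
          exact hadj.reachable.trans (ih hpar)
    exact
      { preconnected := fun x y => (hreach x.1 x.2).trans (hreach y.1 y.2).symm
        nonempty := ⟨⟨u, hu⟩⟩ }
  bag_edge u v huv := by
    rcases hnormal u v huv with ha | ha
    · exact ⟨u, mem_normalBag.2 (.inl rfl), mem_normalBag.2 (.inr ⟨ha, u, .refl, huv⟩)⟩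
    · exact ⟨v, mem_normalBag.2 (.inr ⟨ha, v, .refl, huv.symm⟩), mem_normalBag.2 (.inl rfl)⟩

theorem IsRootedTree.card_normalBag_le [Fintype V] {r : V} {par : V → V} {d : V → ℕ}
    (h : G.IsRootedTree r par d) {n : ℕ} (v : V)
    (hn : ∀ w u, IsAncestor par w u → G.Adj w u → d w ≤ d u + n) :
    (G.normalBag par v).card ≤ n + 1 := by
  have hmaps : ∀ u ∈ G.normalBag par v, d u ∈ Finset.Icc (d v - n) (d v) := by
    intro u hu
    have hle := h.depth_le (isAncestor_of_mem_normalBag hu)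
    rw [Finset.mem_Icc]
    rcases mem_normalBag.1 hu with rfl | ⟨hvu, w, hwv, hwu⟩
    · omega
    · have := hn w u (hwv.trans hvu) hwu
      have := h.depth_le hwv
      omega
  have hinj : Set.InjOn d (G.normalBag par v : Set V) := by
    intro x hx y hy hxy
    rcases (isAncestor_of_mem_normalBag hx).total (isAncestor_of_mem_normalBag hy) with ha | ha
    · exact h.eq_of_depth_eq ha hxy.symm
    · exact (h.eq_of_depth_eq ha hxy).symm
  have := Finset.card_le_card_of_injOn d hmaps hinj
  rw [Nat.card_Icc] at this
  omega

/-- A connected graph of treewidth greater than `n` has a path of length greater than `n` whose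
endpoints are adjacent, that is, a cycle of length greater than `n + 1`. -/
theorem Connected.exists_long_cycle [Fintype V] (hG : G.Connected) {n : ℕ}
    (hn : n < treewidth G) :
    ∃ (u w : V) (p : G.Walk u w), p.IsPath ∧ n < p.length ∧ G.Adj u w := by
  obtain ⟨r⟩ := hG.nonempty
  obtain ⟨par, d, h, hnormal⟩ := hG.exists_normal_isRootedTree r
  by_contra! hcon
  have hback : ∀ w u, IsAncestor par w u → G.Adj w u → d w ≤ d u + n := by
    intro w u hwu hadj
    obtain ⟨p, hp, hlen, -⟩ := h.exists_path hwu
    by_contra hlt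
    exact hcon w u p hp (by omega) hadj
  have hw : (h.treeDecomp hnormal).width ≤ n := by
    refine Nat.sub_le_iff_le_add.2 (Finset.sup_le fun v _ => ?_)
    exact h.card_normalBag_le v hback
  exact absurd ((Nat.sInf_le ⟨h.treeDecomp hnormal, rfl⟩ : treewidth G ≤ _).trans hw)
    (not_le.2 hn)

end SimpleGraph


/-- If `B` is a biconnected graph with treewidth at least `2k - 1` (`k ≥ 1`), then any two
distinct vertices `s`, `t` are joined by a simple path of length at least `k`. -/
theorem stmt_0 {V : Type} [Fintype V] (B : SimpleGraph V)
    (hB : ∀ u v : V, u ≠ v → Biconn B u v)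
    (k : ℕ) (hk : 1 ≤ k) (htw : 2 * k - 1 ≤ treewidth B)
    (s t : V) (hst : s ≠ t) :
    ∃ p : B.Walk s t, p.IsPath ∧ k ≤ p.length := by
  have hconn : B.Connected :=
    { preconnected := preconnected_of_biconn hB
      nonempty := ⟨s⟩ }
  obtain ⟨u, w, P, hP, hlen, huw⟩ := hconn.exists_long_cycle (n := 2 * k - 2) (by omega)
  have hS := SimpleGraph.hasLongPath_of_cycle P hP (k := k) (by omega) huw
  have hS₂ : {z | z ∈ P.support}.Nontrivial :=
    ⟨u, P.start_mem_support, w, P.end_mem_support, huw.ne⟩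
  obtain ⟨p, hp, hk', -⟩ :=
    SimpleGraph.hasLongPath_univ hB hS hS₂ (Set.mem_univ s) (Set.mem_univ t) hst
  exact ⟨p, hp, hk'⟩
end

section
/- Let k ≥ 1 be an integer, let G be a finite simple graph, and let s, t be distinct vertices of G such that tw(G_{s,t}) ≥ 2k − 1. Then G contains a simple (s,t)-path of length at least k. -/
/-- The vertex set of the `(s,t)`-relevant part of `G`: all vertices lying on at least one
simple `(s,t)`-path. -/
def relevantSet {V : Type} (G : SimpleGraph V) (s t : V) : Set V :=
  {v | ∃ p : G.Walk s t, p.IsPath ∧ v ∈ p.support}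

namespace SimpleGraph

variable {V : Type} {G : SimpleGraph V}

/-- A walk inside `D` followed by an edge and a path avoiding `D` can be shortcut to a path. -/
theorem Walk.IsPath.exists_isPath_prepend {D : Set V} {x y b t : V} {R : G.Walk b t}
    (hR : R.IsPath) (hRD : ∀ v ∈ R.support, v ∉ D) (q : G.Walk x y)
    (hq : ∀ v ∈ q.support, v ∈ D) (hyb : G.Adj y b) :
    ∃ W : G.Walk x t, W.IsPath ∧ (∀ v ∈ W.support, v ∈ R.support ∨ v ∈ D) ∧
      ∀ v ∈ R.support, v ∈ W.support := by
  classical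
  have hsub := q.support_bypass_subset_support
  refine ⟨q.bypass.append (.cons hyb R), ?_, ?_, ?_⟩
  · rw [Walk.isPath_def, Walk.support_append, Walk.support_cons, List.tail_cons,
      List.nodup_append]
    refine ⟨q.bypass_isPath.support_nodup, hR.support_nodup, ?_⟩
    rintro v hv w hw rfl
    exact hRD v hw (hq v (hsub hv))
  · intro v hv
    rw [Walk.support_append, Walk.support_cons, List.tail_cons, List.mem_append] at hv
    exact hv.symm.imp_right fun h => hq v (hsub h)
  · intro v hv
    rw [Walk.support_append, Walk.support_cons, List.tail_cons, List.mem_append]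
    exact .inr hv

/-- If a connected set `D` disjoint from a path has at least two neighbours on the path, then
the path can be rerouted through `D` without losing any neighbour of `D`. -/
theorem Walk.IsPath.exists_reroute {D : Set V}
    (hc : ∀ x ∈ D, ∀ y ∈ D, ∃ q : G.Walk x y, ∀ z ∈ q.support, z ∈ D) {u t : V}
    {P : G.Walk u t} (hP : P.IsPath) (hPD : ∀ v ∈ P.support, v ∉ D)
    (h2 : ∃ a ∈ P.support, ∃ b ∈ P.support, a ≠ b ∧ (∃ d ∈ D, G.Adj a d) ∧
      ∃ d ∈ D, G.Adj b d) :
    ∃ P' : G.Walk u t, P'.IsPath ∧ (∀ v ∈ P'.support, v ∈ P.support ∨ v ∈ D) ∧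
      (∃ d ∈ D, d ∈ P'.support) ∧
      ∀ v ∈ P.support, (∃ d ∈ D, G.Adj v d) → v ∈ P'.support := by
  classical
  induction P with
  | nil =>
    obtain ⟨a, ha, b, hb, hab, -⟩ := h2
    simp only [Walk.support_nil, List.mem_singleton] at ha hb
    exact absurd (ha.trans hb.symm) hab
  | @cons u v t huv P ih =>
    rw [Walk.cons_isPath_iff] at hP
    simp only [Walk.support_cons, List.mem_cons, forall_eq_or_imp] at hPD
    by_cases h2' : ∃ a ∈ P.support, ∃ b ∈ P.support, a ≠ b ∧ (∃ d ∈ D, G.Adj a d) ∧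
      ∃ d ∈ D, G.Adj b d
    · obtain ⟨P', hP', hsub, ⟨d, hd, hdP⟩, hN⟩ := ih hP.1 hPD.2 h2'
      refine ⟨.cons huv P', ?_, ?_, ⟨d, hd, ?_⟩, ?_⟩
      · rw [Walk.cons_isPath_iff]
        exact ⟨hP', fun hu => (hsub u hu).elim hP.2 hPD.1⟩
      · simp only [Walk.support_cons, List.mem_cons]
        rintro w (rfl | hw)
        · exact .inl (.inl rfl)
        · exact (hsub w hw).imp_left .inr
      · simp [hdP]
      · simp only [Walk.support_cons, List.mem_cons]
        rintro w (rfl | hw) hwD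
        · exact .inl rfl
        · exact .inr (hN w hw hwD)
    · have key : (∃ d ∈ D, G.Adj u d) ∧ ∃ b ∈ P.support, ∃ d ∈ D, G.Adj b d := by
        obtain ⟨a, ha, b, hb, hab, haD, hbD⟩ := h2
        simp only [Walk.support_cons, List.mem_cons] at ha hb
        obtain rfl | ha := ha
        · exact ⟨haD, b, hb.resolve_left hab.symm, hbD⟩
        · obtain rfl | hb := hb
          · exact ⟨hbD, a, ha, haD⟩
          · exact absurd ⟨a, ha, b, hb, hab, haD, hbD⟩ h2'
      obtain ⟨⟨d₁, hd₁, hud⟩, b, hb, d₂, hd₂, hbd⟩ := key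
      obtain ⟨q, hq⟩ := hc d₁ hd₁ d₂ hd₂
      have hsubd := P.support_dropUntil_subset_support hb
      obtain ⟨W, hW, hsub, hsup⟩ := (hP.1.dropUntil hb).exists_isPath_prepend
        (fun v hv => hPD.2 v (hsubd hv)) q hq hbd.symm
      refine ⟨.cons hud W, ?_, ?_, ⟨d₁, hd₁, ?_⟩, ?_⟩
      · rw [Walk.cons_isPath_iff]
        exact ⟨hW, fun hu => (hsub u hu).elim (fun h => hP.2 (hsubd h)) hPD.1⟩
      · simp only [Walk.support_cons, List.mem_cons]
        rintro w (rfl | hw)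
        · exact .inl (.inl rfl)
        · exact (hsub w hw).imp_left fun h => .inr (hsubd h)
      · simp
      · simp only [Walk.support_cons, List.mem_cons]
        rintro w (rfl | hw) hwD
        · exact .inl rfl
        · have : w = b := by
            by_contra hne
            exact h2' ⟨w, hw, b, hb, hne, hwD, d₂, hd₂, hbd⟩
          subst this
          exact .inr (hsup w (Walk.start_mem_support _))

/-- A path which visits `D` but neither starts nor ends in it passes through two distinct
neighbours of `D`. -/
theorem Walk.IsPath.exists_two_neighbors {D : Set V} {s t d : V} {p : G.Walk s t}
    (hp : p.IsPath) (hs : s ∉ D) (ht : t ∉ D) (hd : d ∈ D) (hdp : d ∈ p.support) :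
    ∃ a b, a ∉ D ∧ b ∉ D ∧ a ≠ b ∧ (∃ x ∈ D, G.Adj a x) ∧ ∃ x ∈ D, G.Adj b x := by
  obtain ⟨q, r, rfl⟩ := p.mem_support_iff_exists_append.mp hdp
  obtain ⟨e, he, he1, he2⟩ := q.exists_boundary_dart Dᶜ hs (by simpa using hd)
  obtain ⟨f, hf, hf1, hf2⟩ := r.exists_boundary_dart D hd ht
  refine ⟨e.fst, f.snd, he1, hf2, ?_, ⟨e.snd, by simpa using he2, e.adj⟩, f.fst, hf1, f.adj.symm⟩
  refine hp.ne_of_mem_support_of_append (fun h => hf2 (h ▸ hd))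
    (q.dart_fst_mem_support_of_mem_darts he) (r.dart_snd_mem_support_of_mem_darts hf)

/-- The graph obtained from `T` by attaching a new leaf `none` to the vertex `i`. -/
def addLeaf {ι : Type} (T : SimpleGraph ι) (i : ι) : SimpleGraph (Option ι) :=
  T.map Function.Embedding.some ⊔ edge none (some i)

section AddLeaf

variable {ι : Type} {T : SimpleGraph ι} {i : ι}

/-- The inclusion of `T` into `T.addLeaf i`. -/
def addLeafHom (T : SimpleGraph ι) (i : ι) : T →g T.addLeaf i where
  toFun := some
  map_rel' h := .inl ((map_adj_apply (f := Function.Embedding.some)).2 h)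

theorem addLeaf_adj_none : (T.addLeaf i).Adj (some i) none :=
  .inr (by simp [edge_adj])

theorem Preconnected.addLeaf_image {S : Set ι} (h : (T.induce S).Preconnected) :
    ((T.addLeaf i).induce (some '' S)).Preconnected := by
  let f : T.induce S →g (T.addLeaf i).induce (some '' S) :=
    { toFun := fun x => ⟨some x, x, x.2, rfl⟩
      map_rel' := fun {x y} h => (addLeafHom T i).map_rel h }
  refine h.map f ?_
  rintro ⟨_, x, hx, rfl⟩
  exact ⟨⟨x, hx⟩, rfl⟩

theorem Preconnected.addLeaf_insert {S : Set ι} (h : (T.induce S).Preconnected) (hi : i ∈ S) :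
    ((T.addLeaf i).induce (some '' S ∪ {none})).Preconnected :=
  (connected_induce_union h.addLeaf_image .of_subsingleton ⟨i, hi, rfl⟩
    (Set.mem_singleton _) addLeaf_adj_none).preconnected

theorem IsTree.addLeaf [Finite ι] (h : T.IsTree) (i : ι) : (T.addLeaf i).IsTree := by
  rw [isTree_iff_connected_and_card] at h ⊢
  refine ⟨connected_iff_exists_forall_reachable _ |>.2 ⟨some i, ?_⟩, ?_⟩
  · rintro (_ | j)
    · exact addLeaf_adj_none.reachable
    · exact (h.1 i j).map (addLeafHom T i)
  · rw [Finite.card_option, ← h.2, SimpleGraph.addLeaf, edgeSet_sup, edgeSet_map,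
      edgeSet_edge_of_ne (by simp), Nat.card_coe_set_eq, Set.union_singleton,
      Set.ncard_insert_of_notMem, Set.ncard_image_of_injective, Nat.card_coe_set_eq]
    · exact (Function.Embedding.sym2Map _).injective
    · rintro ⟨e, -, he⟩
      induction e with
      | _ x y => simp at he

end AddLeaf
end SimpleGraph

namespace SimpleGraph

variable {V : Type} {G : SimpleGraph V} {s t : V}

/-- A tree decomposition of `G.induce X` whose bags are supports of `(s, t)`-paths, such that the
neighbourhood of every component of `G - X` is contained in a bag. -/
structure PathBagDecomp (G : SimpleGraph V) (s t : V) (X : Set V) where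
  ι : Type
  finite : Finite ι
  T : SimpleGraph ι
  isTree : T.IsTree
  path : ι → G.Path s t
  mem_of_mem_path : ∀ i, ∀ v ∈ (path i).1.support, v ∈ X
  exists_mem_path : ∀ v ∈ X, ∃ i, v ∈ (path i).1.support
  preconnected : ∀ v, (T.induce {i | v ∈ (path i).1.support}).Preconnected
  exists_edge : ∀ u ∈ X, ∀ v ∈ X, G.Adj u v →
    ∃ i, u ∈ (path i).1.support ∧ v ∈ (path i).1.support
  exists_attach : ∀ c, c ∉ X → ∃ i, ∀ d, ∀ q : G.Walk c d, (∀ z ∈ q.support, z ∉ X) →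
    ∀ w ∈ X, G.Adj d w → w ∈ (path i).1.support

/-- The decomposition with a single bag. -/
def PathBagDecomp.single (p : G.Path s t) : PathBagDecomp G s t {v | v ∈ p.1.support} where
  ι := Unit
  finite := inferInstance
  T := ⊥
  isTree := .of_subsingleton
  path _ := p
  mem_of_mem_path _ _ h := h
  exists_mem_path _ h := ⟨(), h⟩
  preconnected _ := .of_subsingleton
  exists_edge _ hu _ hv _ := ⟨(), hu, hv⟩
  exists_attach _ _ := ⟨(), fun _ _ _ _ hw _ => hw⟩

/-- If every vertex lies on an `(s, t)`-path, a decomposition not covering the whole graph can be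
extended by attaching one more bag. -/
theorem PathBagDecomp.exists_extend
    (hrel : ∀ v, ∃ p : G.Walk s t, p.IsPath ∧ v ∈ p.support) {X : Set V}
    (A : PathBagDecomp G s t X) {c : V} (hcX : c ∉ X) :
    ∃ Y, X ⊂ Y ∧ Nonempty (PathBagDecomp G s t Y) := by
  classical
  obtain ⟨i, hi⟩ := A.exists_attach c hcX
  let D : Set V := {d | ∃ q : G.Walk c d, ∀ z ∈ q.support, z ∉ X}
  have hDX : ∀ d ∈ D, d ∉ X := fun d ⟨q, hq⟩ => hq d q.end_mem_support
  have hcD : c ∈ D := ⟨.nil, by simpa using hcX⟩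
  have hDadj : ∀ d ∈ D, ∀ w, G.Adj d w → w ∉ X → w ∈ D := by
    rintro d ⟨q, hq⟩ w hdw hw
    refine ⟨q.concat hdw, fun z hz => ?_⟩
    rw [Walk.support_concat, List.mem_append, List.mem_singleton] at hz
    obtain hz | rfl := hz
    exacts [hq z hz, hw]
  have hwalk : ∀ d ∈ D, ∀ e, ∀ q : G.Walk d e, (∀ z ∈ q.support, z ∉ X) → e ∈ D := by
    rintro d ⟨p, hp⟩ e q hq
    refine ⟨p.append q, fun z hz => ?_⟩
    rw [Walk.mem_support_append_iff] at hz
    exact hz.elim (hp z) (hq z)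
  have hc : ∀ x ∈ D, ∀ y ∈ D, ∃ q : G.Walk x y, ∀ z ∈ q.support, z ∈ D := by
    have key : ∀ x ∈ D, ∃ q : G.Walk c x, ∀ z ∈ q.support, z ∈ D := by
      rintro x ⟨q, hq⟩
      exact ⟨q, fun z hz => ⟨q.takeUntil z hz,
        fun y hy => hq y (q.support_takeUntil_subset_support hz hy)⟩⟩
    intro x hx y hy
    obtain ⟨p, hp⟩ := key x hx
    obtain ⟨q, hq⟩ := key y hy
    refine ⟨p.reverse.append q, fun z hz => ?_⟩
    rw [Walk.mem_support_append_iff, Walk.support_reverse, List.mem_reverse] at hz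
    exact hz.elim (hp z) (hq z)
  have hN : ∀ w, w ∉ D → (∃ d ∈ D, G.Adj w d) → w ∈ (A.path i).1.support := by
    rintro w hw ⟨d, hd, hwd⟩
    have hwX : w ∈ X := by_contra fun h => hw (hDadj d hd w hwd.symm h)
    obtain ⟨q, hq⟩ := hd
    exact hi d q hq w hwX hwd.symm
  have hPD : ∀ v ∈ (A.path i).1.support, v ∉ D :=
    fun v hv hvD => hDX v hvD (A.mem_of_mem_path i v hv)
  obtain ⟨p, hp, hcp⟩ := hrel c
  obtain ⟨a, b, ha, hb, hab, haD, hbD⟩ := hp.exists_two_neighbors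
    (hPD s (Walk.start_mem_support _)) (hPD t (Walk.end_mem_support _)) hcD hcp
  obtain ⟨Q, hQ, hQsub, ⟨d₀, hd₀, hd₀Q⟩, hNQ⟩ := (A.path i).2.exists_reroute hc hPD
    ⟨a, hN a ha haD, b, hN b hb hbD, hab, haD, hbD⟩
  have hNQ' : ∀ w, w ∉ D → ∀ d ∈ D, G.Adj w d → w ∈ Q.support :=
    fun w hw d hd h => hNQ w (hN w hw ⟨d, hd, h⟩) ⟨d, hd, h⟩
  have hQX : ∀ v ∈ Q.support, v ∈ X ∨ v ∈ D :=
    fun v hv => (hQsub v hv).imp_left (A.mem_of_mem_path i v)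
  refine ⟨X ∪ {v | v ∈ Q.support}, ?_, ⟨?_⟩⟩
  · refine ⟨Set.subset_union_left, fun h => hDX d₀ hd₀ (h (.inr hd₀Q))⟩
  have := A.finite
  exact
    { ι := Option A.ι
      finite := inferInstance
      T := A.T.addLeaf i
      isTree := A.isTree.addLeaf i
      path := fun j => j.elim ⟨Q, hQ⟩ A.path
      mem_of_mem_path := by
        rintro (_ | j) v hv
        exacts [.inr hv, .inl (A.mem_of_mem_path j v hv)]
      exists_mem_path := by
        rintro v (hv | hv)
        · obtain ⟨j, hj⟩ := A.exists_mem_path v hv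
          exact ⟨some j, hj⟩
        · exact ⟨none, hv⟩
      preconnected := by
        intro v
        by_cases hvQ : v ∈ Q.support
        · by_cases hvX : v ∈ X
          · have hvi : v ∈ (A.path i).1.support :=
              (hQsub v hvQ).resolve_right fun h => hDX v h hvX
            have hset : {j : Option A.ι |
                v ∈ (j.elim (⟨Q, hQ⟩ : G.Path s t) A.path).1.support} =
                some '' {j | v ∈ (A.path j).1.support} ∪ {none} := by
              ext (_ | j) <;> simp [hvQ]
            rw [hset]
            exact (A.preconnected v).addLeaf_insert hvi
          · have hset : {j : Option A.ι |
                v ∈ (j.elim (⟨Q, hQ⟩ : G.Path s t) A.path).1.support} = {none} := by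
              ext (_ | j)
              · simp [hvQ]
              · simpa using fun h => hvX (A.mem_of_mem_path j v h)
            rw [hset]
            exact .of_subsingleton
        · have hset : {j : Option A.ι |
              v ∈ (j.elim (⟨Q, hQ⟩ : G.Path s t) A.path).1.support} =
              some '' {j | v ∈ (A.path j).1.support} := by
            ext (_ | j) <;> simp [hvQ]
          rw [hset]
          exact (A.preconnected v).addLeaf_image
      exists_edge := by
        have key : ∀ u v, u ∈ X → v ∈ Q.support → v ∉ X → G.Adj u v → u ∈ Q.support :=
          fun u v hu hv hvX huv => hNQ' u (fun h => hDX u h hu) v ((hQX v hv).resolve_left hvX) huv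
        intro u hu v hv huv
        by_cases huX : u ∈ X <;> by_cases hvX : v ∈ X
        · obtain ⟨j, hj⟩ := A.exists_edge u huX v hvX huv
          exact ⟨some j, hj⟩
        · have hvQ := hv.resolve_left hvX
          exact ⟨none, key u v huX hvQ hvX huv, hvQ⟩
        · have huQ := hu.resolve_left huX
          exact ⟨none, huQ, key v u hvX huQ huX huv.symm⟩
        · exact ⟨none, hu.resolve_left huX, hv.resolve_left hvX⟩
      exists_attach := by
        intro e he
        by_cases heD : e ∈ D
        · refine ⟨none, fun d q hq w hw hdw => ?_⟩
          have hd : d ∈ D := hwalk e heD d q fun z hz h => hq z hz (.inl h)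
          refine hw.elim (fun hwX => ?_) id
          exact hNQ' w (fun h => hDX w h hwX) d hd hdw.symm
        · obtain ⟨j, hj⟩ := A.exists_attach e fun h => he (.inl h)
          refine ⟨some j, fun d q hq w hw hdw => ?_⟩
          have hq' : ∀ z ∈ q.support, z ∉ X := fun z hz h => hq z hz (.inl h)
          have hdD : d ∉ D := fun h =>
            heD (hwalk d h e q.reverse (by simpa using hq'))
          refine hj d q hq' w (by_contra fun hwX => ?_) hdw
          have hwD := (hQX w (hw.resolve_left hwX)).resolve_left hwX
          exact hdD (hDadj w hwD d hdw.symm (hq' d q.end_mem_support)) }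

/-- If every vertex lies on an `(s, t)`-path, there is a tree decomposition all of whose bags are
supports of `(s, t)`-paths. -/
theorem nonempty_pathBagDecomp_univ [Finite V]
    (hrel : ∀ v, ∃ p : G.Walk s t, p.IsPath ∧ v ∈ p.support) :
    Nonempty (PathBagDecomp G s t Set.univ) := by
  obtain ⟨p, hp, -⟩ := hrel s
  obtain ⟨X, hX⟩ := (Set.toFinite {X | Nonempty (PathBagDecomp G s t X)}).exists_maximal
    ⟨_, ⟨PathBagDecomp.single ⟨p, hp⟩⟩⟩
  obtain ⟨A⟩ := hX.prop
  suffices hXu : X = Set.univ from hXu ▸ ⟨A⟩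
  refine Set.eq_univ_of_forall fun c => by_contra fun hc => ?_
  obtain ⟨Y, hXY, hY⟩ := A.exists_extend hrel hc
  exact hXY.2 (hX.le_of_ge hY hXY.1)

/-- If every vertex lies on an `(s, t)`-path and all such paths have length at most `n`, then the
treewidth is at most `n`. -/
theorem treewidth_le_of_forall_isPath_length_le [Finite V] {n : ℕ}
    (hrel : ∀ v, ∃ p : G.Walk s t, p.IsPath ∧ v ∈ p.support)
    (hlen : ∀ p : G.Walk s t, p.IsPath → p.length ≤ n) : treewidth G ≤ n := by
  classical
  obtain ⟨A⟩ := nonempty_pathBagDecomp_univ hrel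
  have := A.finite
  let td : TreeDecomp G :=
    { ι := A.ι
      instFin := Fintype.ofFinite _
      T := A.T
      isTree := A.isTree
      bag := fun i => (A.path i).1.support.toFinset
      bag_conn := by
        intro v
        obtain ⟨i, hi⟩ := A.exists_mem_path v trivial
        have hset : {i | v ∈ (A.path i).1.support.toFinset} =
            {i | v ∈ (A.path i).1.support} := by simp
        rw [hset]
        have : Nonempty {i | v ∈ (A.path i).1.support} := ⟨⟨i, hi⟩⟩
        exact ⟨A.preconnected v⟩
      bag_edge := by
        intro u v huv
        simpa only [List.mem_toFinset] using A.exists_edge u trivial v trivial huv }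
  refine (Nat.sInf_le ⟨td, rfl⟩ : treewidth G ≤ td.width).trans ?_
  rw [TreeDecomp.width, Nat.sub_le_iff_le_add]
  refine Finset.sup_le fun i _ => (List.toFinset_card_le _).trans ?_
  rw [Walk.length_support]
  exact Nat.add_le_add_right (hlen _ (A.path i).2) 1

/-- The treewidth of a graph without vertices is zero. -/
theorem treewidth_of_isEmpty [IsEmpty V] : treewidth G = 0 := by
  let td : TreeDecomp G :=
    { ι := Unit
      instFin := inferInstance
      T := ⊥
      isTree := .of_subsingleton
      bag := fun _ => ∅
      bag_conn := isEmptyElim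
      bag_edge := fun u => isEmptyElim u }
  exact Nat.le_zero.1 (Nat.sInf_le ⟨td, by simp [TreeDecomp.width, td]⟩)

end SimpleGraph

/-- If the `(s,t)`-relevant part of `G` has treewidth at least `2k - 1` (`k ≥ 1`), then `G`
contains a simple `(s,t)`-path of length at least `k`. -/
theorem stmt_1 {V : Type} [Fintype V] (G : SimpleGraph V) (s t : V) (hst : s ≠ t)
    (k : ℕ) (hk : 1 ≤ k)
    (htw : 2 * k - 1 ≤ treewidth (SimpleGraph.induce (relevantSet G s t) G)) :
    ∃ p : G.Walk s t, p.IsPath ∧ k ≤ p.length := by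

  by_contra! hshort
  have hle : treewidth (SimpleGraph.induce (relevantSet G s t) G) ≤ k - 1 := by
    by_cases h : ∃ p : G.Walk s t, p.IsPath
    · obtain ⟨p, hp⟩ := h
      have hs : s ∈ relevantSet G s t := ⟨p, hp, p.start_mem_support⟩
      have ht : t ∈ relevantSet G s t := ⟨p, hp, p.end_mem_support⟩
      refine SimpleGraph.treewidth_le_of_forall_isPath_length_le
        (s := ⟨s, hs⟩) (t := ⟨t, ht⟩) ?_ ?_
      · rintro ⟨v, q, hq, hv⟩
        have hqR : ∀ x ∈ q.support, x ∈ relevantSet G s t := fun x hx => ⟨q, hq, hx⟩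
        refine ⟨q.induce _ hqR, ?_, ?_⟩
        · refine SimpleGraph.Walk.IsPath.of_map
            (f := (SimpleGraph.Embedding.induce (G := G) (relevantSet G s t)).toHom) ?_
          rwa [SimpleGraph.Walk.map_induce]
        · rw [SimpleGraph.Walk.support_induce]
          simpa using hv
      · intro q hq
        have hlt := hshort (q.map (SimpleGraph.Embedding.induce (relevantSet G s t)).toHom)
          (hq.map Subtype.val_injective)
        have hlen := q.length_map
          (SimpleGraph.Embedding.induce (G := G) (relevantSet G s t)).toHom
        exact Nat.le_sub_one_of_lt (hlen ▸ hlt)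
    · have : IsEmpty (relevantSet G s t) := ⟨fun ⟨_, p, hp, _⟩ => h ⟨p, hp⟩⟩
      rw [SimpleGraph.treewidth_of_isEmpty]
      exact Nat.zero_le _
  omega
end

section
/- Let B be a 2-connected finite simple graph that contains a cycle C with ℓ edges. Then for any two distinct vertices s, t of B there exists a simple (s,t)-path P in B with 2·|E(P)| ≥ ℓ, i.e., a path of length at least ℓ/2. -/
namespace SimpleGraph

variable {V : Type*} {G : SimpleGraph V}

lemma Connected.exists_walk_notMem_support {v a b : V} (h : (G.induce {x | x ≠ v}).Connected)
    (ha : a ≠ v) (hb : b ≠ v) : ∃ p : G.Walk a b, v ∉ p.support := by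
  obtain ⟨p⟩ := h.preconnected ⟨a, ha⟩ ⟨b, hb⟩
  refine ⟨p.map (Embedding.induce _).toHom, fun hv => ?_⟩
  obtain ⟨x, -, hx⟩ := List.mem_map.1 (Walk.support_map _ p ▸ hv)
  exact x.2 hx

lemma Walk.exists_first_mem {a b : V} (p : G.Walk a b) {T : Set V} (hb : b ∈ T) :
    ∃ z ∈ T, ∃ q : G.Walk a z, q.support ⊆ p.support ∧ ∀ x ∈ q.support, x ∈ T → x = z := by
  induction p with
  | @nil u => exact ⟨u, hb, .nil, by simp, by simp⟩
  | @cons u v w h p ih =>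
    by_cases hu : u ∈ T
    · exact ⟨u, hu, .nil, by simp, by simp⟩
    · obtain ⟨z, hz, q, hqp, hq⟩ := ih hb
      refine ⟨z, hz, .cons h q, ?_, ?_⟩
      · simpa using List.cons_subset_cons u hqp
      · intro x hx hxT
        rcases List.mem_cons.1 hx with rfl | hx
        · exact absurd hxT hu
        · exact hq x hx hxT

lemma Walk.IsPath.append_of_forall {a b c : V} {p : G.Walk a b} {q : G.Walk b c}
    (hp : p.IsPath) (hq : q.IsPath) (h : ∀ x ∈ p.support, x ∈ q.support → x = b) :
    (p.append q).IsPath := by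
  have hn := hq.support_nodup
  rw [← q.cons_tail_support, List.nodup_cons] at hn
  rw [Walk.isPath_def, Walk.support_append, List.nodup_append']
  refine ⟨hp.support_nodup, hn.2, fun x hx hx' => hn.1 ?_⟩
  exact h x hx (List.mem_of_mem_tail hx') ▸ hx'

lemma Walk.IsPath.start_notMem_support_dropUntil [DecidableEq V] {a b z : V} {p : G.Walk a b}
    (hp : p.IsPath) (hz : z ∈ p.support) (hza : z ≠ a) : a ∉ (p.dropUntil z hz).support := by
  intro ha
  have hn := hp.support_nodup
  rw [← p.take_spec hz, Walk.support_append, List.nodup_append'] at hn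
  refine hn.2.2 (Walk.start_mem_support _) ?_
  rw [← Walk.cons_tail_support, List.mem_cons] at ha
  exact ha.resolve_left hza.symm

/-- There are two vertex-disjoint walks, one from `s` and one from `t`, that end in `S`. -/
def DisjointlyLinked (G : SimpleGraph V) (S : Set V) (s t : V) : Prop :=
  ∃ x ∈ S, ∃ y ∈ S, ∃ (p : G.Walk s x) (q : G.Walk t y), p.support.Disjoint q.support

lemma DisjointlyLinked.symm {S : Set V} {s t : V} (h : G.DisjointlyLinked S s t) :
    G.DisjointlyLinked S t s := by
  obtain ⟨x, hx, y, hy, p, q, hpq⟩ := h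
  exact ⟨y, hy, x, hx, q, p, hpq.symm⟩

/-- Moving one of the two starting vertices along an edge, by rerouting the other walk. -/
lemma DisjointlyLinked.of_adj (hdel : ∀ v : V, (G.induce {x | x ≠ v}).Connected) {S : Set V}
    {s t u : V} (hst : s ≠ t) (hadj : G.Adj t u) (h : G.DisjointlyLinked S s u) :
    G.DisjointlyLinked S s t := by
  classical
  obtain ⟨x, hx, y, hy, p, q, hpq⟩ := h
  by_cases htp : t ∈ p.support
  · obtain ⟨r, hr, hrp⟩ : ∃ r : G.Walk t x, r.IsPath ∧ r.support ⊆ p.support :=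
      ⟨(p.dropUntil t htp).bypass, Walk.bypass_isPath _,
        fun _ hv => p.support_dropUntil_subset_support htp (Walk.support_bypass_subset_support _ hv)⟩
    have hrq : r.support.Disjoint q.support := fun v hv hv' => hpq (hrp hv) hv'
    obtain ⟨w, htw⟩ := (hdel t).exists_walk_notMem_support hst hadj.ne'
    obtain ⟨z, hz, w, hww, hw⟩ := w.exists_first_mem
      (T := {v | v ∈ r.support ∨ v ∈ q.support}) (Or.inr q.start_mem_support)
    replace htw : t ∉ w.support := fun h => htw (hww h)
    have hzt : z ≠ t := fun h => htw (h ▸ w.end_mem_support)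
    by_cases hzr : z ∈ r.support
    · refine ⟨x, hx, y, hy, w.append (r.dropUntil z hzr), .cons hadj q, fun v hv hv' => ?_⟩
      rw [Walk.mem_support_append_iff] at hv
      rcases List.mem_cons.1 hv' with rfl | hv'
      · exact hv.elim htw (hr.start_notMem_support_dropUntil hzr hzt)
      · rcases hv with hv | hv
        · obtain rfl := hw v hv (Or.inr hv')
          exact hrq hzr hv'
        · exact hrq (r.support_dropUntil_subset_support hzr hv) hv'
    · have hzq : z ∈ q.support := hz.resolve_left hzr
      refine ⟨y, hy, x, hx, w.append (q.dropUntil z hzq), r, fun v hv hv' => ?_⟩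
      rw [Walk.mem_support_append_iff] at hv
      rcases hv with hv | hv
      · obtain rfl := hw v hv (Or.inl hv')
        exact hzr hv'
      · exact hrq hv' (q.support_dropUntil_subset_support hzq hv)
  · refine ⟨x, hx, y, hy, p, .cons hadj q, fun v hv hv' => ?_⟩
    rcases List.mem_cons.1 hv' with rfl | hv'
    · exact htp hv
    · exact hpq hv hv'

lemma Walk.disjointlyLinked (hdel : ∀ v : V, (G.induce {x | x ≠ v}).Connected) {S : Set V}
    (hS : S.Nontrivial) {t y : V} (p : G.Walk t y) (hy : y ∈ S) {s : V} (hst : s ≠ t) :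
    G.DisjointlyLinked S s t := by
  induction p generalizing s with
  | @nil t =>
    obtain ⟨x, hx, hxt⟩ := hS.exists_ne t
    obtain ⟨p, hp⟩ := (hdel t).exists_walk_notMem_support hst hxt
    exact ⟨x, hx, t, hy, p, .nil, by simpa using hp⟩
  | @cons t u y hadj p ih =>
    by_cases hsu : s = u
    · subst hsu
      exact (ih hy hst.symm).symm
    · exact (ih hy hsu).of_adj hdel hst hadj

/-- Two distinct vertices of a cycle are joined by an arc with at least half of its edges. -/
lemma Walk.IsCycle.exists_isPath_length_le {a x y : V} {c : G.Walk a a} (hc : c.IsCycle)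
    (hx : x ∈ c.support) (hy : y ∈ c.support) (hxy : x ≠ y) :
    ∃ p : G.Walk x y, p.IsPath ∧ p.support ⊆ c.support ∧ c.length ≤ 2 * p.length := by
  classical
  have hmem (v : V) := c.mem_support_rotate_iff (w := v) x hx
  have hy' : y ∈ (c.rotate x hx).support := (hmem y).2 hy
  have hlen : (c.rotate x hx).length = c.length := by
    have := congrArg Walk.length (c.take_spec hx)
    simp only [Walk.rotate, Walk.length_append] at this ⊢
    omega
  have hsum := congrArg Walk.length ((c.rotate x hx).take_spec hy')
  rw [Walk.length_append, hlen] at hsum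
  have hc' := hc.rotate hx
  rcases le_total ((c.rotate x hx).dropUntil y hy').length
    ((c.rotate x hx).takeUntil y hy').length with h | h
  · refine ⟨_, hc'.isPath_takeUntil hy', fun v hv => ?_, by omega⟩
    exact (hmem v).1 (Walk.support_takeUntil_subset_support _ hy' hv)
  · refine ⟨((c.rotate x hx).dropUntil y hy').reverse, ?_, fun v hv => ?_, ?_⟩
    · refine Walk.IsPath.reverse ?_
      rw [← (c.rotate x hx).take_spec hy'] at hc'
      exact Walk.IsCycle.isPath_of_append_right (Walk.not_nil_of_ne hxy) hc'
    · rw [Walk.support_reverse, List.mem_reverse] at hv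
      exact (hmem v).1 (Walk.support_dropUntil_subset_support _ hy' hv)
    · rw [Walk.length_reverse]
      omega

lemma Walk.IsCycle.nontrivial_support {a : V} {c : G.Walk a a} (hc : c.IsCycle) :
    {v | v ∈ c.support}.Nontrivial :=
  ⟨a, c.start_mem_support, c.snd, c.getVert_mem_support 1, (c.adj_snd hc.not_nil).ne⟩

lemma DisjointlyLinked.exists_isPath {a s t : V} {c : G.Walk a a} (hc : c.IsCycle)
    (h : G.DisjointlyLinked {v | v ∈ c.support} s t) :
    ∃ p : G.Walk s t, p.IsPath ∧ c.length ≤ 2 * p.length := by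
  classical
  obtain ⟨x', hx', y', hy', p', q', hpq'⟩ := h
  obtain ⟨x, hx, p, hpp, hp⟩ := p'.exists_first_mem hx'
  obtain ⟨y, hy, q, hqq, hq⟩ := q'.exists_first_mem hy'
  have hpq : ∀ v ∈ p.bypass.support, v ∉ q.bypass.support := fun v hv hv' =>
    hpq' (hpp (p.support_bypass_subset_support hv)) (hqq (q.support_bypass_subset_support hv'))
  have hxy : x ≠ y := by
    rintro rfl
    exact hpq x (Walk.end_mem_support _) (Walk.end_mem_support _)
  obtain ⟨r, hr, hrc, hlen⟩ := hc.exists_isPath_length_le hx hy hxy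
  have hrq : (r.append q.bypass.reverse).IsPath := by
    refine hr.append_of_forall q.bypass_isPath.reverse fun v hv hv' => ?_
    rw [Walk.support_reverse, List.mem_reverse] at hv'
    exact hq v (q.support_bypass_subset_support hv') (hrc hv)
  refine ⟨p.bypass.append (r.append q.bypass.reverse),
    p.bypass_isPath.append_of_forall hrq fun v hv hv' => ?_, ?_⟩
  · rw [Walk.mem_support_append_iff, Walk.support_reverse, List.mem_reverse] at hv'
    exact hp v (p.support_bypass_subset_support hv) (hrc (hv'.resolve_right (hpq v hv)))
  · simp only [Walk.length_append]
    omega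

end SimpleGraph


/-- If `B` is 2-connected and contains a cycle with `ℓ` edges, then any two distinct vertices
`s`, `t` are joined by a simple path `p` with `2 * |E(p)| ≥ ℓ`. -/
theorem stmt_2 {V : Type} [Fintype V] (B : SimpleGraph V)
    (hcard : 3 ≤ Fintype.card V) (hconn : B.Connected)
    (hdel : ∀ v : V, (SimpleGraph.induce {x | x ≠ v} B).Connected)
    (ℓ : ℕ) (a : V) (c : B.Walk a a) (hc : c.IsCycle) (hlen : c.length = ℓ)
    (s t : V) (hst : s ≠ t) :
    ∃ p : B.Walk s t, p.IsPath ∧ ℓ ≤ 2 * p.length := by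
  subst hlen
  obtain ⟨w⟩ := hconn.preconnected t a
  exact (w.disjointlyLinked hdel hc.nontrivial_support c.start_mem_support hst).exists_isPath hc
end

section
/- Let G be a finite simple graph and let s, t, b be pairwise distinct vertices of G. Then b lies on some simple (s,t)-path in G if and only if, in the graph G + st, the vertex b is biconnected with s and b is biconnected with t. -/
/-- `G + uv`: the graph obtained from `G` by adding the edge `uv`. -/
def addEdge {V : Type} (G : SimpleGraph V) (u v : V) : SimpleGraph V :=
  G ⊔ SimpleGraph.fromEdgeSet {s(u, v)}

namespace SimpleGraph.Walk

variable {V : Type*} {G : SimpleGraph V} {u v w : V}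

/-- Two paths that meet only at the common endpoint concatenate to a path. -/
lemma IsPath.append_of_forall_s3 {p : G.Walk u v} {q : G.Walk v w} (hp : p.IsPath) (hq : q.IsPath)
    (h : ∀ x ∈ p.support, x ∈ q.support → x = v) : (p.append q).IsPath := by
  induction p with
  | nil => simpa using hq
  | cons ha p ih =>
    rw [cons_isPath_iff] at hp
    rw [cons_append, cons_isPath_iff]
    refine ⟨ih hp.1 hq fun x hx => h x (by simp [hx]), ?_⟩
    rw [mem_support_append_iff, not_or]
    refine ⟨hp.2, fun hm => hp.2 ?_⟩
    rw [h _ (by simp) hm]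
    exact p.end_mem_support

/-- A path that meets `S` has a final segment that meets `S` exactly in its first vertex. -/
lemma IsPath.exists_suffix_meeting_only_start {q : G.Walk u v} (hq : q.IsPath) (S : Set V)
    (hS : ∃ x ∈ q.support, x ∈ S) :
    ∃ z ∈ S, z ∈ q.support ∧ ∃ r : G.Walk z v, r.IsPath ∧ ∀ x ∈ r.support, x ∈ S → x = z := by
  induction q with
  | nil =>
    obtain ⟨x, hx, hxS⟩ := hS
    obtain rfl := mem_support_nil_iff.mp hx
    exact ⟨x, hxS, hx, Walk.nil, IsPath.nil, by simp⟩
  | @cons a c d ha q ih =>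
    by_cases hex : ∃ y ∈ q.support, y ∈ S
    · obtain ⟨z, hzS, hzq, r, hr⟩ := ih hq.of_cons hex
      exact ⟨z, hzS, by simp [hzq], r, hr⟩
    · push Not at hex
      have only_start : ∀ x ∈ (cons ha q).support, x ∈ S → x = a := fun x hx hxS =>
        (List.mem_cons.mp hx).resolve_right fun h => hex x h hxS
      obtain ⟨x, hx, hxS⟩ := hS
      exact ⟨a, only_start x hx hxS ▸ hxS, by simp, cons ha q, hq, only_start⟩

/-- If two `(b, s)`-paths meet only in their endpoints, and a path from `b` to `t` starts on the
first of them at `z ≠ s` and otherwise avoids both, then some `(s, t)`-path contains `b`. -/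
lemma IsPath.exists_isPath_through_of_branch {b s t z : V} {p q : G.Walk b s} {r : G.Walk z t}
    (hp : p.IsPath) (hq : q.IsPath) (hr : r.IsPath)
    (hpq : ∀ x ∈ p.support, x ∈ q.support → x = b ∨ x = s) (hzs : z ≠ s) (hz : z ∈ p.support)
    (hrp : ∀ x ∈ r.support, x ∈ p.support → x = z)
    (hrq : ∀ x ∈ r.support, x ∈ q.support → x = z) :
    ∃ w : G.Walk s t, w.IsPath ∧ b ∈ w.support := by
  classical
  have hsub := p.support_takeUntil_subset_support hz
  have hs := endpoint_notMem_support_takeUntil hp hz hzs.symm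
  refine ⟨q.reverse.append ((p.takeUntil z hz).append r),
    hq.reverse.append_of_forall_s3 ((hp.takeUntil hz).append_of_forall_s3 hr
      fun x hx hxr => hrp x hxr (hsub hx)) fun x hx hx' => ?_, by simp⟩
  rw [support_reverse, List.mem_reverse] at hx
  have hxp : x ∈ (p.takeUntil z hz).support := by
    rcases (mem_support_append_iff _ _).mp hx' with h | h
    · exact h
    · rw [hrq x h hx]
      exact end_mem_support _
  exact (hpq x (hsub hxp) hx).resolve_right fun h => hs (h ▸ hxp)

end SimpleGraph.Walk

section

open SimpleGraph Walk

variable {V : Type} {G : SimpleGraph V} {u v s t b : V}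

lemma addEdge_adj : (addEdge G s t).Adj u v ↔ G.Adj u v ∨ s(u, v) = s(s, t) ∧ u ≠ v := by
  simp [addEdge]

/-- Adding the edge `st` does not change which vertices lie inside an `(s, t)`-path. -/
lemma exists_isPath_addEdge_iff (hsb : s ≠ b) (htb : t ≠ b) :
    (∃ p : (addEdge G s t).Walk s t, p.IsPath ∧ b ∈ p.support) ↔
      ∃ p : G.Walk s t, p.IsPath ∧ b ∈ p.support := by
  constructor
  · rintro ⟨p, hp, hb⟩
    have hedge : s(s, t) ∉ p.edges := by
      cases p with
      | nil => simp
      | @cons _ u _ h p =>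
        rw [cons_isPath_iff] at hp
        rw [edges_cons, List.mem_cons, not_or]
        refine ⟨fun he => ?_, fun he => hp.2 (p.fst_mem_support_of_mem_edges he)⟩
        obtain rfl : t = u := Sym2.congr_right.mp he
        obtain rfl := (isPath_iff_nil.mp hp.1).eq_nil
        simp [hsb.symm, htb.symm] at hb
    have hG : ∀ e ∈ p.edges, e ∈ G.edgeSet := by
      intro e he
      have hmem := p.edges_subset_edgeSet he
      induction e with
      | h x y => exact (addEdge_adj.mp hmem).resolve_right fun h => hedge (h.1 ▸ he)
    exact ⟨p.transfer G hG, hp.transfer hG, by simpa using hb⟩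
  · rintro ⟨p, hp, hb⟩
    exact ⟨p.mapLe le_sup_left, hp.mapLe _, (support_mapLe_eq_support ..).symm ▸ hb⟩

/-- Biconnected vertices are joined by two internally disjoint paths, possibly equal. -/
lemma Biconn.exists_paths (h : Biconn G u v) :
    ∃ p q : G.Walk u v, p.IsPath ∧ q.IsPath ∧
      ∀ x ∈ p.support, x ∈ q.support → x = u ∨ x = v := by
  rcases h with h | h
  · exact ⟨h.toWalk, h.toWalk, by simp [h.ne], by simp [h.ne], by simp⟩
  · exact h

lemma Biconn.exists_isPath_avoiding (h : Biconn G u v) {x : V} (hu : x ≠ u) (hv : x ≠ v) :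
    ∃ p : G.Walk u v, p.IsPath ∧ x ∉ p.support := by
  obtain ⟨p, q, hp, hq, hpq⟩ := h.exists_paths
  by_cases hx : x ∈ p.support
  · exact ⟨q, hq, fun hxq => (hpq x hx hxq).elim hu hv⟩
  · exact ⟨p, hp, hx⟩

lemma Biconn.exists_isPath_through (hs : Biconn G b s) (ht : Biconn G b t) (hst : s ≠ t)
    (hsb : s ≠ b) : ∃ p : G.Walk s t, p.IsPath ∧ b ∈ p.support := by
  obtain ⟨p, q, hp, hq, hpq⟩ := hs.exists_paths
  obtain ⟨r₀, hr₀, hsr₀⟩ := ht.exists_isPath_avoiding hsb hst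
  obtain ⟨z, hz, hzr₀, r, hr, hmeet⟩ := hr₀.exists_suffix_meeting_only_start
    {x | x ∈ p.support ∨ x ∈ q.support} ⟨b, by simp⟩
  have hzs : z ≠ s := fun h => hsr₀ (h ▸ hzr₀)
  have hrp : ∀ x ∈ r.support, x ∈ p.support → x = z := fun x hx h => hmeet x hx (.inl h)
  have hrq : ∀ x ∈ r.support, x ∈ q.support → x = z := fun x hx h => hmeet x hx (.inr h)
  rcases hz with hz | hz
  · exact hp.exists_isPath_through_of_branch hq hr hpq hzs hz hrp hrq
  · exact hq.exists_isPath_through_of_branch hp hr (fun x h h' => hpq x h' h) hzs hz hrq hrp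

/-- A vertex inside an `(s, t)`-path is biconnected with `s` as soon as `s` and `t` are
adjacent. -/
lemma SimpleGraph.Walk.IsPath.biconn_start {p : G.Walk s t} (hp : p.IsPath) (hb : b ∈ p.support)
    (hadj : G.Adj s t) : Biconn G b s := by
  obtain ⟨q, r, hq, hr, rfl⟩ := hp.mem_support_iff_exists_append.mp hb
  have hmeet : ∀ x ∈ q.support, x ∈ r.support → x = b := fun x hx hx' => by
    by_contra hxb
    exact hp.ne_of_mem_support_of_append hxb hx hx' rfl
  have hsr : s = b ∨ s ∉ r.support := or_iff_not_imp_right.mpr fun h =>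
    hmeet s q.start_mem_support (not_not.mp h)
  rcases hsr with rfl | hsr
  · exact .inr ⟨Walk.nil, Walk.nil, IsPath.nil, IsPath.nil, by simp⟩
  refine .inr ⟨q.reverse, r.concat hadj.symm, hq.reverse, hr.concat hsr _, fun x hx hx' => ?_⟩
  rw [support_concat] at hx'
  rw [support_reverse, List.mem_reverse] at hx
  rcases List.mem_append.mp hx' with h | h
  · exact .inl (hmeet x hx h)
  · exact .inr (List.mem_singleton.mp h)

end

/-- For pairwise distinct `s, t, b`, the vertex `b` lies on some simple `(s,t)`-path in `G` iff
in `G + st` the vertex `b` is biconnected with `s` and biconnected with `t`. -/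
theorem stmt_3 {V : Type} [Fintype V] (G : SimpleGraph V) (s t b : V)
    (hst : s ≠ t) (hsb : s ≠ b) (htb : t ≠ b) :
    (∃ p : G.Walk s t, p.IsPath ∧ b ∈ p.support) ↔
      (Biconn (addEdge G s t) b s ∧ Biconn (addEdge G s t) b t) := by
  rw [← exists_isPath_addEdge_iff hsb htb]
  have hadj : (addEdge G s t).Adj s t := addEdge_adj.mpr (.inr ⟨rfl, hst⟩)
  constructor
  · rintro ⟨p, hp, hb⟩
    exact ⟨hp.biconn_start hb hadj, hp.reverse.biconn_start (by simpa using hb) hadj.symm⟩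
  · rintro ⟨hs, ht⟩
    exact hs.exists_isPath_through ht hst hsb
end

section
/- Let G be a 2-connected finite simple graph and let s, t, b be pairwise distinct vertices of G. Then G contains a simple (s,t)-path that passes through b. -/
namespace SimpleGraph

variable {V : Type*} {G : SimpleGraph V}

/-- A walk ending in `S` can be shortened to a path that meets `S` only in its last vertex. -/
theorem Walk.exists_isPath_first_mem {a b : V} (r : G.Walk a b) {S : Set V} (hb : b ∈ S) :
    ∃ x ∈ S, ∃ q : G.Walk a x, q.IsPath ∧ q.support ⊆ r.support ∧
      ∀ y ∈ q.support, y ∈ S → y = x := by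
  classical
  suffices h : ∃ x ∈ S, ∃ q : G.Walk a x, q.support ⊆ r.support ∧
      ∀ y ∈ q.support, y ∈ S → y = x by
    obtain ⟨x, hx, q, hq, hqS⟩ := h
    exact ⟨x, hx, q.bypass, q.bypass_isPath, fun y hy => hq (q.support_bypass_subset_support hy),
      fun y hy => hqS y (q.support_bypass_subset_support hy)⟩
  induction r with
  | nil => exact ⟨_, hb, .nil, by simp, by simp⟩
  | @cons a c b h r ih =>
    by_cases ha : a ∈ S
    · exact ⟨a, ha, .nil, by simp, by simp⟩
    · obtain ⟨x, hx, q, hq, hqS⟩ := ih hb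
      refine ⟨x, hx, .cons h q, ?_, ?_⟩
      · simp only [Walk.support_cons]
        exact List.cons_subset_cons _ hq
      · intro y hy hyS
        rw [Walk.support_cons, List.mem_cons] at hy
        rcases hy with rfl | hy
        · exact absurd hyS ha
        · exact hqS y hy hyS

/-- Two paths that meet only in their common endpoint concatenate to a path. -/
theorem Walk.IsPath.append_of_forall_mem {a x c : V} {p : G.Walk a x} {q : G.Walk x c}
    (hp : p.IsPath) (hq : q.IsPath) (h : ∀ y ∈ p.support, y ∈ q.support → y = x) :
    (p.append q).IsPath := by
  rw [Walk.isPath_def, Walk.support_append, List.nodup_append']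
  have hq' := hq.support_nodup
  rw [← Walk.cons_tail_support, List.nodup_cons] at hq'
  refine ⟨hp.support_nodup, hq'.2, fun y hy hyq => ?_⟩
  have := h y hy (List.mem_of_mem_tail hyq)
  exact hq'.1 (this ▸ hyq)

/-- If deleting `w` leaves a connected graph, any two vertices other than `w` are joined by a walk
avoiding `w`. -/
theorem exists_walk_notMem_support {w : V} (hdel : (induce {x | x ≠ w} G).Connected) {a b : V}
    (ha : a ≠ w) (hb : b ≠ w) :
    ∃ r : G.Walk a b, w ∉ r.support := by
  obtain ⟨r⟩ := hdel.preconnected ⟨a, ha⟩ ⟨b, hb⟩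
  refine ⟨r.map (Embedding.induce _).toHom, fun h => ?_⟩
  obtain ⟨y, -, hy⟩ := List.mem_map.mp ((r.support_map (Embedding.induce _).toHom) ▸ h)
  exact y.2 hy

/-- If a cycle through `w` and `b` is given as a path from `w` to a neighbour `v` of `w`, and
`w` is not a cut vertex, then every `s ≠ w` has a path to `w` through `b`. -/
theorem Walk.IsPath.exists_isPath_through {s b v w : V} {d : G.Walk w v} (hd : d.IsPath)
    (hb : b ∈ d.support) (hbw : b ≠ w) (hvw : G.Adj v w) (hsw : s ≠ w)
    (hdel : (induce {x | x ≠ w} G).Connected) :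
    ∃ p : G.Walk s w, p.IsPath ∧ b ∈ p.support := by
  classical
  obtain ⟨r, hr⟩ := exists_walk_notMem_support hdel hsw hbw
  obtain ⟨x, hx, q, hq, hqr, hqd⟩ := r.exists_isPath_first_mem (S := {y | y ∈ d.support}) hb
  have hwq : w ∉ q.support := fun h => hr (hqr h)
  have hxw : x ≠ w := fun h => hwq (h ▸ q.end_mem_support)
  have hx : x ∈ d.support := hx
  have hb' := hb
  rw [← d.take_spec hx, Walk.mem_support_append_iff] at hb'
  rcases hb' with hb' | hb'
  · refine ⟨q.append (d.takeUntil x hx).reverse, hq.append_of_forall_mem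
      (hd.takeUntil hx).reverse fun y hy hyd => hqd y hy ?_, ?_⟩
    · rw [Walk.support_reverse, List.mem_reverse] at hyd
      exact d.support_takeUntil_subset_support hx hyd
    · simp [Walk.mem_support_append_iff, hb']
  · have hwd : w ∉ (d.dropUntil x hx).support := by
      intro h
      have hn := hd.support_nodup
      rw [← d.take_spec hx, Walk.support_append, List.nodup_append'] at hn
      refine hn.2.2 (Walk.start_mem_support _) ?_
      rw [← Walk.cons_tail_support, List.mem_cons] at h
      exact h.resolve_left hxw.symm
    have hqd' : (q.append (d.dropUntil x hx)).IsPath :=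
      hq.append_of_forall_mem (hd.dropUntil hx) fun y hy hyd =>
        hqd y hy (d.support_dropUntil_subset_support hx hyd)
    refine ⟨(q.append (d.dropUntil x hx)).concat hvw, hqd'.concat ?_ hvw, ?_⟩
    · simp [Walk.mem_support_append_iff, hwq, hwd]
    · simp [Walk.support_concat, Walk.mem_support_append_iff, hb']

/-- Paths from `s` through `b` propagate along edges whose head is not a cut vertex. -/
theorem Walk.IsPath.exists_isPath_through_of_adj {s b v w : V} {p : G.Walk s v} (hp : p.IsPath)
    (hb : b ∈ p.support) (hvw : G.Adj v w) (hsw : s ≠ w)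
    (hdel : (induce {x | x ≠ w} G).Connected) :
    ∃ p : G.Walk s w, p.IsPath ∧ b ∈ p.support := by
  classical
  by_cases hw : w ∈ p.support
  · by_cases hbt : b ∈ (p.takeUntil w hw).support
    · exact ⟨p.takeUntil w hw, hp.takeUntil hw, hbt⟩
    · have hbw : b ≠ w := fun h => hbt (by rw [h]; exact Walk.end_mem_support _)
      rw [← p.take_spec hw, Walk.mem_support_append_iff] at hb
      exact (hp.dropUntil hw).exists_isPath_through (hb.resolve_left hbt) hbw hvw hsw hdel
  · exact ⟨p.concat hvw, hp.concat hw hvw, by simp [Walk.support_concat, hb]⟩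

end SimpleGraph

/-- In a 2-connected graph, for pairwise distinct vertices `s, t, b` there is a simple
`(s,t)`-path passing through `b`. -/
theorem stmt_4 {V : Type} [Fintype V] (G : SimpleGraph V)
    (hcard : 3 ≤ Fintype.card V) (hconn : G.Connected)
    (hdel : ∀ v : V, (SimpleGraph.induce {x | x ≠ v} G).Connected)
    (s t b : V) (hst : s ≠ t) (hsb : s ≠ b) (htb : t ≠ b) :
    ∃ p : G.Walk s t, p.IsPath ∧ b ∈ p.support := by
  obtain ⟨r, hr⟩ := SimpleGraph.exists_walk_notMem_support (hdel s) hsb.symm hst.symm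
  obtain ⟨p, hp⟩ := hconn.exists_isPath s b
  have key : ∀ {v w : V} (r : G.Walk v w), s ∉ r.support →
      (∃ p : G.Walk s v, p.IsPath ∧ b ∈ p.support) →
      ∃ p : G.Walk s w, p.IsPath ∧ b ∈ p.support := by
    intro v w r
    induction r with
    | nil => exact fun _ h => h
    | @cons v c w h r ih =>
      rintro hs ⟨p, hp, hb⟩
      rw [SimpleGraph.Walk.support_cons, List.mem_cons, not_or] at hs
      exact ih hs.2 (hp.exists_isPath_through_of_adj hb h
        (fun hsc => hs.2 (hsc ▸ r.start_mem_support)) (hdel c))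
  exact key r hr ⟨p, hp, p.end_mem_support⟩
end
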